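/- Let A, θ, B ⊆ A, Z = A − B as usual. The following are equivalent: (i) β_Z(B) is a partially commutative code (B is a transitively factorizing subalphabet); (ii) for all distinct z₁, z₂ ∈ Z and traces w₁, w₂, w'₁, w'₂ with z₁w₁, z₂w₂, z₁w'₁, z₂w'₂ ∈ β_Z(B), the equality z₁w₁·z₂w₂ = z₂w'₂·z₁w'₁ implies w₁ = w'₁ and w₂ = w'₂; (iii) for every (z,z') ∈ Z² ∩ θ, the dependence graph contains no path from z to z' all of whose inner vertices lie in B. -/

import Mathlib

namespace PCM

variable {A : Type*}

/-- Elementary commutation relation on words. -/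
def TraceRel (θ : A → A → Prop) : FreeMonoid A → FreeMonoid A → Prop :=
  fun x y => ∃ a b, θ a b ∧ x = FreeMonoid.of a * FreeMonoid.of b ∧
    y = FreeMonoid.of b * FreeMonoid.of a

/-- The congruence generated by the commutations. -/
def traceCon (θ : A → A → Prop) : Con (FreeMonoid A) := conGen (TraceRel θ)

/-- The free partially commutative (trace) monoid `M(A,θ)`. -/
abbrev Trace (A : Type*) (θ : A → A → Prop) := (traceCon θ).Quotient

/-- Canonical projection from words to traces. -/
def trMk (θ : A → A → Prop) : FreeMonoid A →* Trace A θ := (traceCon θ).mk'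

/-- The trace of a single letter. -/
def trOf (θ : A → A → Prop) (a : A) : Trace A θ := trMk θ (FreeMonoid.of a)

/-- `IA t` : the set of possible initial letters of a trace. -/
def IA (θ : A → A → Prop) (t : Trace A θ) : Set A := {a | ∃ w, t = trOf θ a * w}

/-- The alphabet of a trace. -/
def Alph (θ : A → A → Prop) (t : Trace A θ) : Set A :=
  {a | ∃ l : List A, trMk θ (FreeMonoid.ofList l) = t ∧ a ∈ l}

/-- The submonoid `M(B,θ_B)` generated by a subalphabet. -/
def subTr (θ : A → A → Prop) (B : Set A) : Submonoid (Trace A θ) :=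
  Submonoid.closure (trOf θ '' B)

/-- `β_Z(B)` where `Z = A - B`. -/
def beta (θ : A → A → Prop) (B : Set A) : Set (Trace A θ) :=
  {t | ∃ z, z ∉ B ∧ ∃ w ∈ subTr θ B, t = trOf θ z * w ∧ IA θ t = {z}}

/-- The induced independence relation `θ_X` on a set of traces. -/
def thetaX (θ : A → A → Prop) (X : Set (Trace A θ)) (x y : X) : Prop :=
  ∀ a ∈ Alph θ (x : Trace A θ), ∀ b ∈ Alph θ (y : Trace A θ), θ a b

/-- `X` is a partially commutative code : the canonical morphism from
`M(X,θ_X)` is injective. -/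
def IsPCCode (θ : A → A → Prop) (X : Set (Trace A θ)) : Prop :=
  ∃ f : Trace X (thetaX θ X) →* Trace A θ,
    (∀ x : X, f (trOf (thetaX θ X) x) = (x : Trace A θ)) ∧ Function.Injective f

/-- Dependence relation (edges of the dependence graph). -/
def dep (θ : A → A → Prop) (a b : A) : Prop := a ≠ b ∧ ¬ θ a b

/-- A path `z - b₁ - ⋯ - bₙ - z'` in the dependence graph with inner vertices in `B`. -/
def DepPathB (θ : A → A → Prop) (B : Set A) (z z' : A) : Prop :=
  ∃ l : List A, (∀ b ∈ l, b ∈ B) ∧ List.Chain (dep θ) z (l ++ [z'])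

/-- `B` is a transitively factorizing subalphabet. -/
def IsTFSA (θ : A → A → Prop) (B : Set A) : Prop :=
  ∀ z z', z ∉ B → z' ∉ B → θ z z' → ¬ DepPathB θ B z z'


section Helpers

variable {θ : A → A → Prop}

/-- The trace of a list. -/
def mkL (θ : A → A → Prop) (l : List A) : Trace A θ := trMk θ (FreeMonoid.ofList l)

theorem mkL_nil : mkL θ [] = 1 := map_one (trMk θ)

theorem mkL_append (u v : List A) : mkL θ (u ++ v) = mkL θ u * mkL θ v := by
  simp [mkL, FreeMonoid.ofList_append]

theorem mkL_cons (a : A) (v : List A) : mkL θ (a :: v) = trOf θ a * mkL θ v := by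
  simp [mkL, trOf, FreeMonoid.ofList_cons]

theorem mkL_surj (t : Trace A θ) : ∃ l, mkL θ l = t := by
  obtain ⟨w, rfl⟩ := Con.mk'_surjective t
  exact ⟨FreeMonoid.toList w, rfl⟩

theorem trOf_comm {a b : A} (h : θ a b) : trOf θ a * trOf θ b = trOf θ b * trOf θ a := by
  have : traceCon θ (FreeMonoid.of a * FreeMonoid.of b) (FreeMonoid.of b * FreeMonoid.of a) :=
    ConGen.Rel.of _ _ ⟨a, b, h, rfl, rfl⟩
  exact (Con.eq (traceCon θ)).2 this

/-- Lifting a monoid morphism to the trace monoid. -/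
def trLift {M : Type*} [Monoid M] (g : A → M) (h : ∀ a b, θ a b → g a * g b = g b * g a) :
    Trace A θ →* M :=
  (traceCon θ).lift (FreeMonoid.lift g) (by
    refine Con.conGen_le.2 ?_
    rintro x y ⟨a, b, hab, rfl, rfl⟩
    simp [Con.ker_rel, h a b hab])

theorem trLift_of {M : Type*} [Monoid M] (g : A → M)
    (h : ∀ a b, θ a b → g a * g b = g b * g a) (a : A) : trLift g h (trOf θ a) = g a := by
  have : trLift g h (trOf θ a) = FreeMonoid.lift g (FreeMonoid.of a) := rfl
  simpa using this

open Classical in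
/-- Left division of a word by a letter. -/
noncomputable def delL (θ : A → A → Prop) (a : A) : List A → Option (Trace A θ)
  | [] => none
  | b :: l => if a = b then some (mkL θ l) else
      if θ a b then (delL θ a l).map (fun s => trOf θ b * s) else none

open Classical in
theorem delL_append (hanti : ∀ a, ¬ θ a a) (a : A) (u v : List A) :
    delL θ a (u ++ v) = match delL θ a u with
      | some s => some (s * mkL θ v)
      | none => if ∀ b ∈ u, θ a b then (delL θ a v).map (fun s => mkL θ u * s) else none := by
  induction u with
  | nil => simp [delL, mkL_nil]
  | cons b u ih =>
    simp only [List.cons_append, delL]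
    by_cases hab : a = b
    · subst hab
      simp [mkL_append]
    · by_cases ht : θ a b
      · simp only [hab, ht, if_false, if_true, ih]
        cases hd : delL θ a u with
        | some s => simp [mul_assoc]
        | none =>
          by_cases hu : ∀ b ∈ u, θ a b
          · have hu2 : ∀ c ∈ b :: u, θ a c := by
              intro c hc
              rcases List.mem_cons.1 hc with rfl | hc
              · exact ht
              · exact hu c hc
            simp only [if_pos hu, if_pos hu2, Option.map_none, Option.map_map]
            congr 1
            funext s
            simp [mkL_cons, mul_assoc]
          · have hu2 : ¬ ∀ c ∈ b :: u, θ a c := fun h => hu (fun c hc => h c (by simp [hc]))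
            simp only [if_neg hu, if_neg hu2, Option.map_none]
      · simp [hab, ht]

theorem delL_congr (hanti : ∀ a, ¬ θ a a) (hsymm : ∀ a b, θ a b → θ b a)
    {u v : FreeMonoid A} (h : traceCon θ u v) :
    (∀ a, a ∈ FreeMonoid.toList u ↔ a ∈ FreeMonoid.toList v) ∧
    ∀ a, delL θ a (FreeMonoid.toList u) = delL θ a (FreeMonoid.toList v) := by
  classical
  have h' : ConGen.Rel (TraceRel θ) u v := h
  induction h' with
  | of x y hxy =>
    obtain ⟨a, b, hab, rfl, rfl⟩ := hxy
    have hne : a ≠ b := fun e => hanti a (by rw [← e] at hab; exact hab)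
    constructor
    · intro c
      simp [FreeMonoid.toList_mul, or_comm]
    · intro c
      have e1 : FreeMonoid.toList (FreeMonoid.of a * FreeMonoid.of b) = [a, b] := rfl
      have e2 : FreeMonoid.toList (FreeMonoid.of b * FreeMonoid.of a) = [b, a] := rfl
      rw [e1, e2]
      simp only [delL]
      by_cases h1 : c = a
      · subst h1
        simp [hne, hab, mkL_cons, mkL_nil]
      · by_cases h2 : c = b
        · subst h2
          simp [h1, hsymm _ _ hab, mkL_cons, mkL_nil]
        · simp [h1, h2]
  | refl => exact ⟨fun _ => Iff.rfl, fun _ => rfl⟩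
  | symm hh ih =>
    have := ih hh
    exact ⟨fun a => (this.1 a).symm, fun a => (this.2 a).symm⟩
  | trans h1 h2 ih1 ih2 =>
    exact ⟨fun a => ((ih1 h1).1 a).trans ((ih2 h2).1 a),
      fun a => ((ih1 h1).2 a).trans ((ih2 h2).2 a)⟩
  | @mul w x y z h1 h2 ih1 ih2 =>
    have i1 := ih1 h1
    have i2 := ih2 h2
    have e1 : mkL θ (FreeMonoid.toList w) = mkL θ (FreeMonoid.toList x) :=
      (Con.eq (traceCon θ)).2 h1
    have e2 : mkL θ (FreeMonoid.toList y) = mkL θ (FreeMonoid.toList z) :=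
      (Con.eq (traceCon θ)).2 h2
    constructor
    · intro a
      simp [FreeMonoid.toList_mul, i1.1 a, i2.1 a]
    · intro a
      rw [FreeMonoid.toList_mul, FreeMonoid.toList_mul, delL_append hanti, delL_append hanti,
        i1.2 a, i2.2 a, e1, e2]
      simp only [i1.1]

theorem mkL_eq_iff {u v : List A} : mkL θ u = mkL θ v ↔
    traceCon θ (FreeMonoid.ofList u) (FreeMonoid.ofList v) := Con.eq (traceCon θ)

theorem delL_some {a : A} {l : List A} {s : Trace A θ} (h : delL θ a l = some s) :
    mkL θ l = trOf θ a * s := by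
  induction l generalizing s with
  | nil => simp [delL] at h
  | cons b l ih =>
    simp only [delL] at h
    split_ifs at h with h1 h2
    · subst h1
      simp only [Option.some.injEq] at h
      rw [mkL_cons, h]
    · simp only [Option.map_eq_some_iff] at h
      obtain ⟨s', hs', rfl⟩ := h
      rw [mkL_cons, ih hs', ← mul_assoc, ← mul_assoc, trOf_comm h2]

theorem mem_IA_iff (hanti : ∀ a, ¬ θ a a) (hsymm : ∀ a b, θ a b → θ b a) (a : A) (l : List A) :
    a ∈ IA θ (mkL θ l) ↔ delL θ a l ≠ none := by
  constructor
  · rintro ⟨w, hw⟩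
    obtain ⟨m, rfl⟩ := mkL_surj w
    rw [← mkL_cons, mkL_eq_iff] at hw
    have := (delL_congr hanti hsymm hw).2 a
    simp only [FreeMonoid.toList_ofList] at this
    rw [this]
    simp [delL]
  · intro h
    obtain ⟨s, hs⟩ := Option.ne_none_iff_exists'.1 h
    exact ⟨s, delL_some hs⟩

theorem trOf_cancel (hanti : ∀ a, ¬ θ a a) (hsymm : ∀ a b, θ a b → θ b a) {a : A}
    {s t : Trace A θ} (h : trOf θ a * s = trOf θ a * t) : s = t := by
  obtain ⟨l, rfl⟩ := mkL_surj s
  obtain ⟨m, rfl⟩ := mkL_surj t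
  rw [← mkL_cons, ← mkL_cons, mkL_eq_iff] at h
  have := (delL_congr hanti hsymm h).2 a
  simpa [delL] using this

theorem tr_cancel (hanti : ∀ a, ¬ θ a a) (hsymm : ∀ a b, θ a b → θ b a)
    {r s t : Trace A θ} (h : r * s = r * t) : s = t := by
  obtain ⟨l, rfl⟩ := mkL_surj r
  induction l with
  | nil => simpa [mkL_nil] using h
  | cons a l ih =>
    rw [mkL_cons, mul_assoc, mul_assoc] at h
    exact ih (trOf_cancel hanti hsymm h)

theorem mem_Alph (hanti : ∀ a, ¬ θ a a) (hsymm : ∀ a b, θ a b → θ b a) (a : A) (l : List A) :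
    a ∈ Alph θ (mkL θ l) ↔ a ∈ l := by
  constructor
  · rintro ⟨m, hm, ha⟩
    have hm' : mkL θ m = mkL θ l := hm
    rw [mkL_eq_iff] at hm'
    have := (delL_congr hanti hsymm hm').1 a
    simpa using this.1 (by simpa using ha)
  · intro h
    exact ⟨l, rfl, h⟩

theorem Alph_mul (hanti : ∀ a, ¬ θ a a) (hsymm : ∀ a b, θ a b → θ b a) (a : A)
    (s t : Trace A θ) : a ∈ Alph θ (s * t) ↔ a ∈ Alph θ s ∨ a ∈ Alph θ t := by
  obtain ⟨l, rfl⟩ := mkL_surj s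
  obtain ⟨m, rfl⟩ := mkL_surj t
  rw [← mkL_append]
  simp [mem_Alph hanti hsymm]

theorem Alph_of (hanti : ∀ a, ¬ θ a a) (hsymm : ∀ a b, θ a b → θ b a) (a b : A) :
    a ∈ Alph θ (trOf θ b) ↔ a = b := by
  have : trOf θ b = mkL θ [b] := rfl
  rw [this, mem_Alph hanti hsymm]
  simp

theorem IA_one (hanti : ∀ a, ¬ θ a a) (hsymm : ∀ a b, θ a b → θ b a) (a : A) :
    a ∉ IA θ (1 : Trace A θ) := by
  rw [← mkL_nil, mem_IA_iff hanti hsymm]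
  simp [delL]

theorem IA_mul (hanti : ∀ a, ¬ θ a a) (hsymm : ∀ a b, θ a b → θ b a) {a : A}
    {s t : Trace A θ} (h : a ∈ IA θ (s * t)) :
    a ∈ IA θ s ∨ ((∀ b ∈ Alph θ s, θ a b) ∧ a ∈ IA θ t) := by
  classical
  obtain ⟨l, rfl⟩ := mkL_surj s
  obtain ⟨m, rfl⟩ := mkL_surj t
  rw [← mkL_append] at h
  simp only [mem_IA_iff hanti hsymm, mem_Alph hanti hsymm] at h ⊢
  rw [delL_append hanti] at h
  cases hd : delL θ a l with
  | some s => simp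
  | none =>
    right
    simp only [hd] at h
    by_cases hu : ∀ b ∈ l, θ a b
    · refine ⟨hu, fun e => h ?_⟩
      simp [e]
    · simp [hu] at h

theorem IA_mul_left {a : A} {s t : Trace A θ} (h : a ∈ IA θ s) : a ∈ IA θ (s * t) := by
  obtain ⟨w, rfl⟩ := h
  exact ⟨w * t, mul_assoc _ _ _⟩

theorem IA_of_mul (a : A) (t : Trace A θ) : a ∈ IA θ (trOf θ a * t) := ⟨t, rfl⟩

theorem letter_comm {a : A} {l : List A} (h : ∀ b ∈ l, θ a b) :
    trOf θ a * mkL θ l = mkL θ l * trOf θ a := by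
  induction l with
  | nil => simp [mkL_nil]
  | cons b l ih =>
    rw [mkL_cons, ← mul_assoc, trOf_comm (h b (by simp)), mul_assoc,
      ih (fun c hc => h c (by simp [hc])), mul_assoc]

theorem tr_comm {s t : Trace A θ} (h : ∀ a ∈ Alph θ s, ∀ b ∈ Alph θ t, θ a b) :
    s * t = t * s := by
  obtain ⟨l, rfl⟩ := mkL_surj s
  obtain ⟨m, rfl⟩ := mkL_surj t
  have h' : ∀ a ∈ l, ∀ b ∈ m, θ a b := fun a ha b hb => h a ⟨l, rfl, ha⟩ b ⟨m, rfl, hb⟩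
  clear h
  induction l with
  | nil => simp [mkL_nil]
  | cons a l ih =>
    rw [mkL_cons, mul_assoc, ih (fun c hc => h' c (by simp [hc])), ← mul_assoc,
      letter_comm (h' a (by simp)), mul_assoc]

theorem mkL_mem_subTr {B : Set A} {l : List A} (h : ∀ b ∈ l, b ∈ B) : mkL θ l ∈ subTr θ B := by
  induction l with
  | nil => rw [mkL_nil]; exact one_mem _
  | cons a l ih =>
    rw [mkL_cons]
    exact mul_mem (Submonoid.subset_closure ⟨a, h a (by simp), rfl⟩)
      (ih (fun c hc => h c (by simp [hc])))

theorem subTr_exists {B : Set A} {t : Trace A θ} (h : t ∈ subTr θ B) :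
    ∃ l, (∀ b ∈ l, b ∈ B) ∧ mkL θ l = t := by
  induction h using Submonoid.closure_induction with
  | mem x hx =>
    obtain ⟨b, hb, rfl⟩ := hx
    exact ⟨[b], by simpa using hb, rfl⟩
  | one => exact ⟨[], by simp, mkL_nil⟩
  | mul x y _ _ hx hy =>
    obtain ⟨l, hl, rfl⟩ := hx
    obtain ⟨m, hm, rfl⟩ := hy
    refine ⟨l ++ m, ?_, mkL_append l m⟩
    intro b hb
    rcases List.mem_append.1 hb with hb | hb
    · exact hl b hb
    · exact hm b hb

/-- Uniqueness of the factorization. -/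
theorem fact_unique (hanti : ∀ a, ¬ θ a a) (hsymm : ∀ a b, θ a b → θ b a) {B : Set A}
    {w w' u u' : Trace A θ} (hw : w ∈ subTr θ B) (hw' : w' ∈ subTr θ B)
    (hu : ∀ b ∈ IA θ u, b ∉ B) (hu' : ∀ b ∈ IA θ u', b ∉ B) (h : w * u = w' * u') :
    w = w' := by
  obtain ⟨l, hl, rfl⟩ := subTr_exists hw
  clear hw
  induction l generalizing w' with
  | nil =>
    rw [mkL_nil, one_mul] at h
    obtain ⟨m, hm, rfl⟩ := subTr_exists hw'
    cases m with
    | nil => rfl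
    | cons b m =>
      exfalso
      refine hu b ?_ (hm b (by simp))
      rw [h, mkL_cons, mul_assoc]
      exact IA_of_mul _ _
  | cons b l ih =>
    have hbB : b ∈ B := hl b (by simp)
    have hb : b ∈ IA θ (w' * u') := by
      rw [← h, mkL_cons, mul_assoc]
      exact IA_of_mul _ _
    rcases IA_mul hanti hsymm hb with hb | ⟨-, hb⟩
    · obtain ⟨v, rfl⟩ := hb
      rw [mkL_cons, mul_assoc, mul_assoc] at h
      have h2 := trOf_cancel hanti hsymm h
      have hv : v ∈ subTr θ B := by
        obtain ⟨m, hm, hm2⟩ := subTr_exists hw'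
        obtain ⟨n, rfl⟩ := mkL_surj v
        apply mkL_mem_subTr
        intro c hc
        apply hm
        rw [← mem_Alph hanti hsymm, hm2, ← mkL_cons, mem_Alph hanti hsymm]
        simp [hc]
      rw [mkL_cons, ih hv (fun c hc => hl c (by simp [hc])) h2]
    · exact absurd hbB (hu' b hb)

/-- Steps in the dependence graph ending in `B`. -/
def stepB (θ : A → A → Prop) (B : Set A) (a b : A) : Prop := dep θ a b ∧ b ∈ B

theorem path_of_reach {B : Set A} {z c z' : A} (h : Relation.ReflTransGen (stepB θ B) z c)
    (hc : dep θ c z') : DepPathB θ B z z' := by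
  induction h using Relation.ReflTransGen.head_induction_on with
  | refl => exact ⟨[], by simp, List.IsChain.cons_cons hc (List.IsChain.singleton _)⟩
  | head h1 _ ih =>
    obtain ⟨l, hl, hch⟩ := ih
    refine ⟨_ :: l, ?_, List.IsChain.cons_cons h1.1 hch⟩
    intro b hb
    rcases List.mem_cons.1 hb with rfl | hb
    · exact h1.2
    · exact hl b hb

theorem reach_contra (hanti : ∀ a, ¬ θ a a) (hsymm : ∀ a b, θ a b → θ b a) {B : Set A}
    (hT : IsTFSA θ B) {z z' a b : A} (hz : z ∉ B) (hz' : z' ∉ B) (hzz : θ z z')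
    (ha : Relation.ReflTransGen (stepB θ B) z a) (hb : Relation.ReflTransGen (stepB θ B) z' b) :
    θ a b := by
  by_contra hab
  induction hb generalizing a with
  | refl =>
    by_cases e : a = z'
    · subst e
      rcases Relation.ReflTransGen.cases_tail ha with e | ⟨c, _, hc⟩
      · subst e; exact hanti _ hzz
      · exact hz' hc.2
    · exact hT z z' hz hz' hzz (path_of_reach ha ⟨e, hab⟩)
  | @tail b' b _ hs ih =>
    have hs' : ¬ θ b b' := fun h => hs.1.2 (hsymm _ _ h)
    by_cases e : a = b
    · subst e
      exact ih ha hs'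
    · exact ih (ha.tail ⟨⟨e, hab⟩, hs.2⟩) hs'

theorem reach_of_IA (hanti : ∀ a, ¬ θ a a) (hsymm : ∀ a b, θ a b → θ b a) {B : Set A}
    {z : A} (hz : z ∉ B) {l : List A} (hl : ∀ b ∈ l, b ∈ B)
    (h : IA θ (trOf θ z * mkL θ l) ⊆ {z}) :
    ∀ a ∈ z :: l, Relation.ReflTransGen (stepB θ B) z a := by
  induction l using List.reverseRecOn with
  | nil => intro a ha; simp at ha; subst ha; exact .refl
  | append_singleton p c ih =>
    have ih' := ih (fun b hb => hl b (by simp [hb])) (fun a ha => h (by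
      rw [mkL_append, ← mul_assoc]; exact IA_mul_left ha))
    have hc : Relation.ReflTransGen (stepB θ B) z c := by
      have hcB : c ∈ B := hl c (by simp)
      by_cases hall : ∀ d ∈ z :: p, θ c d
      · exfalso
        have : c ∈ IA θ (trOf θ z * mkL θ (p ++ [c])) := by
          refine ⟨mkL θ (z :: p), ?_⟩
          rw [letter_comm hall, mkL_append, mkL_cons, mkL_cons, mkL_nil, mul_one, mul_assoc]
        have := h this
        simp at this
        subst this
        exact hz hcB
      · push Not at hall
        obtain ⟨d, hd, hcd⟩ := hall
        by_cases e : d = c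
        · subst e; exact ih' d hd
        · exact (ih' d hd).tail ⟨⟨e, fun h => hcd (hsymm _ _ h)⟩, hcB⟩
    intro a ha
    simp only [List.mem_cons, List.mem_append, List.not_mem_nil, or_false] at ha
    rcases ha with ha | ha | ha
    · exact ih' a (by simp [ha])
    · exact ih' a (by simp [ha])
    · subst ha; exact hc

theorem beta_reach (hanti : ∀ a, ¬ θ a a) (hsymm : ∀ a b, θ a b → θ b a) {B : Set A}
    {z : A} {w : Trace A θ} (hz : z ∉ B) (hw : w ∈ subTr θ B)
    (h : IA θ (trOf θ z * w) ⊆ {z}) :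
    ∀ a ∈ Alph θ (trOf θ z * w), Relation.ReflTransGen (stepB θ B) z a := by
  obtain ⟨l, hl, rfl⟩ := subTr_exists hw
  intro a ha
  rw [← mkL_cons, mem_Alph hanti hsymm] at ha
  exact reach_of_IA hanti hsymm hz hl h a ha

theorem beta_IA {B : Set A} {z : A} {w : Trace A θ} (h : trOf θ z * w ∈ beta θ B) :
    IA θ (trOf θ z * w) = {z} := by
  obtain ⟨z', _, w', _, _, h3⟩ := h
  have : z ∈ IA θ (trOf θ z * w) := IA_of_mul _ _
  rw [h3] at this ⊢
  simp at this
  rw [this]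

theorem beta_theta (hanti : ∀ a, ¬ θ a a) (hsymm : ∀ a b, θ a b → θ b a) {B : Set A}
    (hT : IsTFSA θ B) {z z' : A} (hz : z ∉ B) (hz' : z' ∉ B) (hzz : θ z z')
    {w w' : Trace A θ} (hw : w ∈ subTr θ B) (hw' : w' ∈ subTr θ B)
    (h : IA θ (trOf θ z * w) = {z}) (h' : IA θ (trOf θ z' * w') = {z'}) :
    ∀ a ∈ Alph θ (trOf θ z * w), ∀ b ∈ Alph θ (trOf θ z' * w'), θ a b :=
  fun a ha b hb => reach_contra hanti hsymm hT hz hz' hzz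
    (beta_reach hanti hsymm hz hw h.le a ha) (beta_reach hanti hsymm hz' hw' h'.le b hb)

theorem cond_of_TFSA (hanti : ∀ a, ¬ θ a a) (hsymm : ∀ a b, θ a b → θ b a) {B : Set A}
    (hT : IsTFSA θ B) {z₁ z₂ : A} (hz₁ : z₁ ∉ B) (hz₂ : z₂ ∉ B) (hne : z₁ ≠ z₂)
    {w₁ w₂ w₁' w₂' : Trace A θ} (hw₁ : w₁ ∈ subTr θ B)
    (hw₁' : w₁' ∈ subTr θ B) (hw₂' : w₂' ∈ subTr θ B)
    (h1 : trOf θ z₁ * w₁ ∈ beta θ B) (h2 : trOf θ z₂ * w₂ ∈ beta θ B)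
    (h1' : trOf θ z₁ * w₁' ∈ beta θ B) (h2' : trOf θ z₂ * w₂' ∈ beta θ B)
    (h : (trOf θ z₁ * w₁) * (trOf θ z₂ * w₂) = (trOf θ z₂ * w₂') * (trOf θ z₁ * w₁')) :
    w₁ = w₁' ∧ w₂ = w₂' := by
  have hth : θ z₂ z₁ := by
    have : z₂ ∈ IA θ ((trOf θ z₁ * w₁) * (trOf θ z₂ * w₂)) := by
      rw [h, mul_assoc]; exact IA_of_mul _ _
    rcases IA_mul hanti hsymm this with h3 | ⟨h3, -⟩
    · rw [beta_IA h1] at h3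
      exact absurd h3.symm hne
    · exact h3 z₁ ((Alph_mul hanti hsymm _ _ _).2 (Or.inl ((Alph_of hanti hsymm _ _).2 rfl)))
  have hc := tr_comm (beta_theta hanti hsymm hT hz₂ hz₁ hth hw₂' hw₁' (beta_IA h2') (beta_IA h1'))
  rw [hc] at h
  have h4 := h
  rw [mul_assoc, mul_assoc] at h4
  have h5 := trOf_cancel hanti hsymm h4
  have h6 : w₁ = w₁' := by
    refine fact_unique hanti hsymm hw₁ hw₁' ?_ ?_ h5
    · intro b hb; rw [beta_IA h2] at hb; rw [Set.mem_singleton_iff.1 hb]; exact hz₂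
    · intro b hb; rw [beta_IA h2'] at hb; rw [Set.mem_singleton_iff.1 hb]; exact hz₂
  subst h6
  exact ⟨rfl, trOf_cancel hanti hsymm (tr_cancel hanti hsymm h5)⟩

theorem prod_IA (hanti : ∀ a, ¬ θ a a) (hsymm : ∀ a b, θ a b → θ b a) {X : Set (Trace A θ)}
    {a : A} (L : List X) (h : a ∈ IA θ (L.map Subtype.val).prod) :
    ∃ (L₁ : List X) (y : X) (L₂ : List X), L = L₁ ++ y :: L₂ ∧ a ∈ IA θ y.1 ∧
      ∀ c ∈ L₁, ∀ d ∈ Alph θ c.1, θ a d := by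
  induction L with
  | nil => exact absurd h (by simpa using IA_one hanti hsymm a)
  | cons x L ih =>
    rw [List.map_cons, List.prod_cons] at h
    rcases IA_mul hanti hsymm h with h | ⟨h1, h2⟩
    · exact ⟨[], x, L, rfl, h, by simp⟩
    · obtain ⟨L₁, y, L₂, rfl, hy, hL⟩ := ih h2
      refine ⟨x :: L₁, y, L₂, rfl, hy, ?_⟩
      intro c hc
      rcases List.mem_cons.1 hc with rfl | hc
      · exact h1
      · exact hL c hc

theorem prod_IA_notB (hanti : ∀ a, ¬ θ a a) (hsymm : ∀ a b, θ a b → θ b a) {B : Set A}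
    (L : List (beta θ B)) : ∀ b ∈ IA θ (L.map Subtype.val).prod, b ∉ B := by
  intro b hb
  obtain ⟨_, ⟨y, z, hz, w, hw, rfl, hI⟩, _, -, hy, -⟩ := prod_IA hanti hsymm L hb
  simp only [hI, Set.mem_singleton_iff] at hy
  rw [hy]; exact hz

theorem code_inj (hanti : ∀ a, ¬ θ a a) (hsymm : ∀ a b, θ a b → θ b a) {B : Set A}
    (hT : IsTFSA θ B) (L L' : List (beta θ B))
    (h : (L.map Subtype.val).prod = (L'.map Subtype.val).prod) :
    mkL (thetaX θ (beta θ B)) L = mkL (thetaX θ (beta θ B)) L' := by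
  induction L generalizing L' with
  | nil =>
    cases L' with
    | nil => rfl
    | cons y L' =>
      exfalso
      obtain ⟨y, z, hz, w, hw, rfl, hI⟩ := y
      refine IA_one hanti hsymm z ?_
      simp only [List.map_nil, List.prod_nil, List.map_cons, List.prod_cons] at h
      rw [h, mul_assoc]
      exact IA_of_mul _ _
  | cons x L ih =>
    obtain ⟨x, z, hz, w, hw, rfl, hI⟩ := x
    have hzI : z ∈ IA θ (L'.map Subtype.val).prod := by
      rw [← h, List.map_cons, List.prod_cons, mul_assoc]
      exact IA_of_mul _ _
    obtain ⟨L₁, y, L₂, rfl, hy, hL⟩ := prod_IA hanti hsymm L' hzI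
    obtain ⟨y, z', hz', w', hw', rfl, hI'⟩ := y
    have e : z = z' := by simpa [hI'] using hy
    subst e
    have hth : ∀ c ∈ L₁, thetaX θ (beta θ B) ⟨trOf θ z * w', z, hz', w', hw', rfl, hI'⟩ c := by
      rintro ⟨c, z₂, hz₂, w₂, hw₂, rfl, hI₂⟩ hc
      refine beta_theta hanti hsymm hT hz hz₂ ?_ hw' hw₂ hI' hI₂
      exact hL _ hc z₂ ((Alph_mul hanti hsymm _ _ _).2 (Or.inl ((Alph_of hanti hsymm _ _).2 rfl)))
    have hcm := letter_comm hth
    have hcm2 : trOf θ z * w' * (L₁.map Subtype.val).prod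
        = (L₁.map Subtype.val).prod * (trOf θ z * w') := by
      clear h ih hcm hzI hL hy
      induction L₁ with
      | nil => simp
      | cons c L₁ ih2 =>
        have h1 : trOf θ z * w' * c.1 = c.1 * (trOf θ z * w') := tr_comm (hth c (by simp))
        rw [List.map_cons, List.prod_cons, ← mul_assoc, h1, mul_assoc,
          ih2 (fun d hd => hth d (by simp [hd])), mul_assoc]
    have h2 : trOf θ z * w * (L.map Subtype.val).prod
        = trOf θ z * w' * ((L₁ ++ L₂).map Subtype.val).prod := by
      rw [List.map_append, List.prod_append, ← mul_assoc, hcm2, mul_assoc (List.prod _)]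
      simpa using h
    have h3 := h2
    rw [mul_assoc, mul_assoc] at h3
    have h4 := trOf_cancel hanti hsymm h3
    have h5 : w = w' := fact_unique hanti hsymm hw hw' (prod_IA_notB hanti hsymm _)
      (prod_IA_notB hanti hsymm _) h4
    subst h5
    have h6 := ih _ (tr_cancel hanti hsymm h4)
    rw [mkL_cons, h6, mkL_append, mkL_append, mkL_cons, ← mul_assoc, ← mul_assoc, hcm]

theorem code_of_TFSA (hanti : ∀ a, ¬ θ a a) (hsymm : ∀ a b, θ a b → θ b a) {B : Set A}
    (hT : IsTFSA θ B) : IsPCCode θ (beta θ B) := by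
  have hg : ∀ x y : beta θ B, thetaX θ (beta θ B) x y → x.1 * y.1 = y.1 * x.1 :=
    fun x y h => tr_comm h
  refine ⟨trLift (fun x => x.1) hg, trLift_of _ hg, ?_⟩
  have key : ∀ L : List (beta θ B), trLift (fun x => x.1) hg (mkL _ L)
      = (L.map Subtype.val).prod := by
    intro L
    induction L with
    | nil => simp [mkL_nil]
    | cons x L ih => rw [mkL_cons, map_mul, trLift_of, ih]; simp
  intro s t hst
  obtain ⟨L, rfl⟩ := mkL_surj s
  obtain ⟨L', rfl⟩ := mkL_surj t
  rw [key, key] at hst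
  exact code_inj hanti hsymm hT L L' hst

theorem chain_IA (hanti : ∀ a, ¬ θ a a) (hsymm : ∀ a b, θ a b → θ b a) (z : A) (l : List A)
    (h : List.IsChain (dep θ) (z :: l)) : IA θ (trOf θ z * mkL θ l) = {z} := by
  refine Set.Subset.antisymm ?_ (by rintro _ rfl; exact IA_of_mul _ _)
  induction l generalizing z with
  | nil =>
    intro a ha
    rcases IA_mul hanti hsymm ha with ⟨w, hw⟩ | ⟨_, ha⟩
    · have := (Alph_of hanti hsymm a z).1 (by
        rw [hw]; exact (Alph_mul hanti hsymm _ _ _).2 (Or.inl ((Alph_of hanti hsymm _ _).2 rfl)))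
      exact this
    · rw [mkL_nil] at ha; exact absurd ha (IA_one hanti hsymm a)
  | cons b l ih =>
    intro a ha
    rcases IA_mul hanti hsymm ha with ⟨w, hw⟩ | ⟨h1, ha⟩
    · have := (Alph_of hanti hsymm a z).1 (by
        rw [hw]; exact (Alph_mul hanti hsymm _ _ _).2 (Or.inl ((Alph_of hanti hsymm _ _).2 rfl)))
      exact this
    · rw [mkL_cons] at ha
      rw [List.isChain_cons_cons] at h
      have := ih b h.2 ha
      rw [Set.mem_singleton_iff] at this
      subst this
      exact absurd (hsymm _ _ (h1 z ((Alph_of hanti hsymm _ _).2 rfl))) h.1.2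

theorem split_path {B : Set A} {z z' : A} (hz' : z' ∉ B) (hzz : θ z z') (l : List A)
    (hl : ∀ b ∈ l, b ∈ B) (h : List.IsChain (dep θ) (z :: (l ++ [z']))) :
    ∃ l₁ b, (∀ c ∈ l₁, c ∈ B) ∧ b ∈ B ∧ List.IsChain (dep θ) (z :: (l₁ ++ [b])) ∧
      (∀ c ∈ l₁, θ c z') ∧ dep θ b z' := by
  induction l generalizing z with
  | nil =>
    simp only [List.nil_append, List.isChain_cons_cons] at h
    exact absurd hzz h.1.2
  | cons c l ih =>
    simp only [List.cons_append, List.isChain_cons_cons] at h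
    have hc : c ∈ B := hl c (by simp)
    by_cases hcz : θ c z'
    · obtain ⟨l₁, b, h1, h2, h3, h4, h5⟩ := ih hcz (fun d hd => hl d (by simp [hd])) h.2
      refine ⟨c :: l₁, b, ?_, h2, ?_, ?_, h5⟩
      · intro d hd
        rcases List.mem_cons.1 hd with rfl | hd
        · exact hc
        · exact h1 d hd
      · simp only [List.cons_append, List.isChain_cons_cons]
        exact ⟨h.1, h3⟩
      · intro d hd
        rcases List.mem_cons.1 hd with rfl | hd
        · exact hcz
        · exact h4 d hd
    · refine ⟨[], c, by simp, hc, by simpa using h.1, by simp, ?_, hcz⟩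
      rintro rfl
      exact hz' hc

theorem counterexample (hanti : ∀ a, ¬ θ a a) (hsymm : ∀ a b, θ a b → θ b a) {B : Set A}
    (hT : ¬ IsTFSA θ B) : ∃ z z' : A, z ∉ B ∧ z' ∉ B ∧ z ≠ z' ∧ ∃ w ∈ subTr θ B, ∃ b ∈ B,
      trOf θ z * w ∈ beta θ B ∧ trOf θ z' * trOf θ b ∈ beta θ B ∧
      trOf θ z' * 1 ∈ beta θ B ∧ trOf θ z * (w * trOf θ b) ∈ beta θ B ∧
      (trOf θ z * w) * (trOf θ z' * trOf θ b) = (trOf θ z' * 1) * (trOf θ z * (w * trOf θ b)) := by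
  unfold IsTFSA at hT
  push Not at hT
  obtain ⟨z, z', hz, hz', hzz, l, hl, hch⟩ := hT
  obtain ⟨l₁, b, h1, h2, h3, h4, h5⟩ := split_path hz' hzz l hl hch
  have hsb : trOf θ b ∈ subTr θ B := Submonoid.subset_closure ⟨b, h2, rfl⟩
  have hsl := mkL_mem_subTr (θ := θ) h1
  have e1 : trOf θ b = mkL θ [b] := by rw [mkL_cons, mkL_nil, mul_one]
  refine ⟨z, z', hz, hz', ?_, mkL θ l₁, hsl, b, h2,
    ⟨z, hz, _, hsl, rfl, ?_⟩, ⟨z', hz', _, hsb, rfl, ?_⟩, ⟨z', hz', _, one_mem _, rfl, ?_⟩,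
    ⟨z, hz, _, mul_mem hsl hsb, rfl, ?_⟩, ?_⟩
  · rintro rfl; exact hanti _ hzz
  · apply chain_IA hanti hsymm
    exact List.IsChain.left_of_append (l₁ := z :: l₁) (l₂ := [b]) h3
  · rw [e1]
    apply chain_IA hanti hsymm
    simp only [List.isChain_cons_cons, List.IsChain.singleton, and_true]
    exact ⟨h5.1.symm, fun h => h5.2 (hsymm _ _ h)⟩
  · rw [← mkL_nil]
    exact chain_IA hanti hsymm _ _ (List.IsChain.singleton _)
  · rw [e1, ← mkL_append]
    exact chain_IA hanti hsymm _ _ h3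
  · have : trOf θ z' * mkL θ (z :: l₁) = mkL θ (z :: l₁) * trOf θ z' := by
      apply letter_comm
      intro c hc
      rcases List.mem_cons.1 hc with rfl | hc
      · exact hsymm _ _ hzz
      · exact hsymm _ _ (h4 c hc)
    rw [mkL_cons] at this
    rw [mul_one, ← mul_assoc, ← mul_assoc (trOf θ z), ← mul_assoc (trOf θ z'), this]

theorem trOf_ne_one (hanti : ∀ a, ¬ θ a a) (hsymm : ∀ a b, θ a b → θ b a) (b : A) :
    trOf θ b ≠ 1 := by
  intro h
  refine IA_one hanti hsymm b ?_
  rw [← h]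
  exact ⟨1, (mul_one _).symm⟩

theorem not_code (hanti : ∀ a, ¬ θ a a) (hsymm : ∀ a b, θ a b → θ b a) {B : Set A}
    (hT : ¬ IsTFSA θ B) : ¬ IsPCCode θ (beta θ B) := by
  obtain ⟨z, z', hz, hz', hne, w, hw, b, hb, h1, h2, h3, h4, h⟩ := counterexample hanti hsymm hT
  rintro ⟨f, hf, hinj⟩
  have e : trOf (thetaX θ (beta θ B)) ⟨_, h1⟩ * trOf _ ⟨_, h2⟩
      = trOf (thetaX θ (beta θ B)) ⟨_, h3⟩ * trOf _ ⟨_, h4⟩ := by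
    apply hinj
    rw [map_mul, map_mul, hf, hf, hf, hf]
    exact h
  let g : Trace (beta θ B) (thetaX θ (beta θ B)) →* Multiplicative (Multiset (beta θ B)) :=
    trLift (fun x => Multiplicative.ofAdd {x}) (fun _ _ _ => mul_comm _ _)
  have e2 := congrArg g e
  simp only [g, map_mul, trLift_of, ← ofAdd_add] at e2
  have e3 := Multiplicative.ofAdd.injective e2
  have e4 : (⟨_, h1⟩ : beta θ B) ∈ ({⟨_, h3⟩} + {⟨_, h4⟩} : Multiset (beta θ B)) := by
    rw [← e3]; simp
  rw [Multiset.mem_add, Multiset.mem_singleton, Multiset.mem_singleton, Subtype.mk.injEq,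
    Subtype.mk.injEq] at e4
  rcases e4 with e4 | e4
  · have := beta_IA h1
    rw [e4, beta_IA h3] at this
    exact hne (Set.singleton_injective this).symm
  · have e5 : w * 1 = w * trOf θ b := by rw [mul_one]; exact trOf_cancel hanti hsymm e4
    exact trOf_ne_one hanti hsymm b (tr_cancel hanti hsymm e5).symm

end Helpers

end PCM

open PCM in
/-- equivalence of (i) `β_Z(B)` is a partially commutative code,
(ii) the cancellation condition, (iii) absence of dependence paths between
independent letters of `Z` through `B`. -/
theorem stmt_3 {A : Type*} [Fintype A] (θ : A → A → Prop)
    (hanti : ∀ a, ¬ θ a a) (hsymm : ∀ a b, θ a b → θ b a) (B : Set A) :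
    (IsPCCode θ (beta θ B) ↔ IsTFSA θ B) ∧
    ((∀ z₁ z₂ : A, z₁ ∉ B → z₂ ∉ B → z₁ ≠ z₂ →
        ∀ w₁ ∈ subTr θ B, ∀ w₂ ∈ subTr θ B, ∀ w₁' ∈ subTr θ B, ∀ w₂' ∈ subTr θ B,
          trOf θ z₁ * w₁ ∈ beta θ B → trOf θ z₂ * w₂ ∈ beta θ B →
          trOf θ z₁ * w₁' ∈ beta θ B → trOf θ z₂ * w₂' ∈ beta θ B →
          (trOf θ z₁ * w₁) * (trOf θ z₂ * w₂) = (trOf θ z₂ * w₂') * (trOf θ z₁ * w₁') →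
          w₁ = w₁' ∧ w₂ = w₂') ↔ IsTFSA θ B) := by
  refine ⟨⟨fun h => ?_, code_of_TFSA hanti hsymm⟩, ⟨fun h => ?_, ?_⟩⟩
  · by_contra hT
    exact not_code hanti hsymm hT h
  · by_contra hT
    obtain ⟨z, z', hz, hz', hne, w, hw, b, hb, h1, h2, h3, h4, e⟩ :=
      counterexample hanti hsymm hT
    have hsb : trOf θ b ∈ subTr θ B := Submonoid.subset_closure ⟨b, hb, rfl⟩
    exact trOf_ne_one hanti hsymm b
      (h z z' hz hz' hne w hw _ hsb _ (mul_mem hw hsb) _ (one_mem _) h1 h2 h4 h3 e).2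
  · intro hT z₁ z₂ hz₁ hz₂ hne w₁ hw₁ w₂ _ w₁' hw₁' w₂' hw₂' h1 h2 h1' h2' h
    exact cond_of_TFSA hanti hsymm hT hz₁ hz₂ hne hw₁ hw₁' hw₂' h1 h2 h1' h2' h
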